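/- Let D ⊆ ℝⁿ be open, f : D → ℝᵐ locally Lipschitz, g : E → ℝᵏ continuously differentiable on an open set E ⊆ ℝᵐ with f(D) ⊆ E, and p ∈ D. Then ∂(g∘f)(p) ⊆ Dg(f(p)) ∘ ∂f(p) := {Dg(f(p))·A : A ∈ ∂f(p)}, with equality if Dg(f(p)) is injective. -/

import Mathlib

open Filter Topology Pointwise

/-- `f` is locally Lipschitz on `D`. -/
def LocallyLipschitzOnSet {X Y : Type*} [NormedAddCommGroup X] [NormedSpace ℝ X]
    [NormedAddCommGroup Y] [NormedSpace ℝ Y] (D : Set X) (f : X → Y) : Prop :=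
  ∀ p ∈ D, ∃ K : NNReal, ∃ U ∈ 𝓝 p, LipschitzOnWith K f U

/-- The points of `D` where `f` is differentiable. -/
def diffPts {n m : ℕ} (D : Set (EuclideanSpace ℝ (Fin n)))
    (f : EuclideanSpace ℝ (Fin n) → EuclideanSpace ℝ (Fin m)) :
    Set (EuclideanSpace ℝ (Fin n)) :=
  {x | x ∈ D ∧ DifferentiableAt ℝ f x}

/-- Pourciau's generalized Jacobian. -/
noncomputable def pourciauJacobian {n m : ℕ} (D : Set (EuclideanSpace ℝ (Fin n)))
    (f : EuclideanSpace ℝ (Fin n) → EuclideanSpace ℝ (Fin m))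
    (p : EuclideanSpace ℝ (Fin n)) :
    Set (EuclideanSpace ℝ (Fin n) →L[ℝ] EuclideanSpace ℝ (Fin m)) :=
  ⋂ δ ∈ Set.Ioi (0 : ℝ),
    closure (convexHull ℝ (fderiv ℝ f '' (Metric.ball p δ ∩ diffPts D f)))

/-- Clarke's generalized Jacobian. -/
noncomputable def clarkeJacobian {n m : ℕ} (D : Set (EuclideanSpace ℝ (Fin n)))
    (f : EuclideanSpace ℝ (Fin n) → EuclideanSpace ℝ (Fin m))
    (p : EuclideanSpace ℝ (Fin n)) :
    Set (EuclideanSpace ℝ (Fin n) →L[ℝ] EuclideanSpace ℝ (Fin m)) :=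
  convexHull ℝ {A | ∃ u : ℕ → EuclideanSpace ℝ (Fin n),
    (∀ i, u i ∈ diffPts D f) ∧ Tendsto u atTop (𝓝 p) ∧
    Tendsto (fun i => fderiv ℝ f (u i)) atTop (𝓝 A)}

section LipschitzDerivatives

open MeasureTheory Metric Set Module
open scoped NNReal

section ConvexHull

variable {V : Type*} [NormedAddCommGroup V] [NormedSpace ℝ V]

theorem IsCompact.convexJoin_real {s t : Set V} (hs : IsCompact s) (ht : IsCompact t) :
    IsCompact (convexJoin ℝ s t) := by
  have himage : convexJoin ℝ s t =
      (fun q : ℝ × V × V => (1 - q.1) • q.2.1 + q.1 • q.2.2) '' (Icc 0 1 ×ˢ s ×ˢ t) := by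
    ext x
    simp only [mem_convexJoin, segment_eq_image, mem_image, Prod.exists, mem_prod]
    constructor
    · rintro ⟨a, ha, b, hb, θ, hθ, rfl⟩
      exact ⟨θ, a, b, ⟨hθ, ha, hb⟩, rfl⟩
    · rintro ⟨θ, a, b, ⟨hθ, ha, hb⟩, rfl⟩
      exact ⟨a, ha, b, hb, θ, hθ, rfl⟩
  rw [himage]
  exact (isCompact_Icc.prod (hs.prod ht)).image (by fun_prop)

/-- A compact subset of the convex hull of `s` exhausting all convex combinations of at most
`N` points of `s`. -/
theorem IsCompact.exists_compact_convexHull_finset_subset {s : Set V} (hs : IsCompact s) (N : ℕ) :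
    ∃ c ⊆ convexHull ℝ s, IsCompact c ∧
      ∀ t : Finset V, ↑t ⊆ s → t.card ≤ N → convexHull ℝ (t : Set V) ⊆ c := by
  classical
  rcases s.eq_empty_or_nonempty with rfl | hne
  · refine ⟨∅, empty_subset _, isCompact_empty, fun t ht _ => ?_⟩
    rw [subset_empty_iff.1 ht, convexHull_empty]
  induction N with
  | zero =>
    refine ⟨∅, empty_subset _, isCompact_empty, fun t _ hcard => ?_⟩
    simp [Finset.card_eq_zero.1 (Nat.le_zero.1 hcard)]
  | succ N ih =>
    obtain ⟨c, hcs, hc, hct⟩ := ih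
    refine ⟨s ∪ convexJoin ℝ s c, union_subset (subset_convexHull ℝ s)
      (convexJoin_subset (subset_convexHull ℝ s) hcs (convex_convexHull ℝ s)),
      hs.union (hs.convexJoin_real hc), fun t hts hcard => ?_⟩
    rcases t.eq_empty_or_nonempty with rfl | ⟨a, ha⟩
    · simp
    have hat : insert a (t.erase a) = t := Finset.insert_erase ha
    rcases (t.erase a).eq_empty_or_nonempty with hempty | hnonempty
    · rw [← hat, hempty]
      simpa using Or.inl (hts ha)
    · rw [← hat, Finset.coe_insert, convexHull_insert (by exact_mod_cast hnonempty)]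
      refine (convexJoin_mono (singleton_subset_iff.2 (hts ha)) (hct _ ?_ ?_)).trans
        subset_union_right
      · exact (Finset.coe_subset.2 (t.erase_subset a)).trans hts
      · rw [Finset.card_erase_of_mem ha]
        omega

theorem IsCompact.convexHull_of_finiteDimensional [FiniteDimensional ℝ V] {s : Set V}
    (hs : IsCompact s) : IsCompact (convexHull ℝ s) := by
  obtain ⟨c, hcs, hc, hct⟩ := hs.exists_compact_convexHull_finset_subset (finrank ℝ V + 1)
  convert hc
  refine Subset.antisymm ?_ hcs
  rw [convexHull_eq_union]
  refine iUnion_subset fun t => iUnion_subset fun hts => iUnion_subset fun hind => hct t hts ?_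
  simpa using hind.card_le_finrank_succ.trans
    (Nat.add_le_add_right (Submodule.finrank_le _) 1)

end ConvexHull

section Averaging

theorem Filter.Tendsto.clm_of_forall_apply {V W ι : Type*} [NormedAddCommGroup V]
    [NormedSpace ℝ V] [FiniteDimensional ℝ V] [NormedAddCommGroup W] [NormedSpace ℝ W]
    {l : Filter ι} {M : ι → V →L[ℝ] W}
    {A : V →L[ℝ] W} (hM : ∀ v, Tendsto (fun i => M i v) l (𝓝 (A v))) : Tendsto M l (𝓝 A) := by
  let e : (V →L[ℝ] W) ≃L[ℝ] (Fin (finrank ℝ V) → W) :=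
    ((ContinuousLinearEquiv.ofFinrankEq (finrank_fin_fun ℝ).symm).arrowCongr
      (1 : W ≃L[ℝ] W)).trans (ContinuousLinearEquiv.piRing _)
  rw [e.toHomeomorph.isInducing.tendsto_nhds_iff]
  exact tendsto_pi_nhds.2 fun i => hM _

variable {V W : Type*} [NormedAddCommGroup V] [NormedSpace ℝ V] [FiniteDimensional ℝ V]
  [MeasurableSpace V] [BorelSpace V] [NormedAddCommGroup W] [NormedSpace ℝ W]
  [FiniteDimensional ℝ W] {μ : Measure V} {C : ℝ≥0} {h : V → W}

theorem LipschitzWith.integrable_smul_fderiv (hh : LipschitzWith C h) {φ : V → ℝ}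
    (hφ : Integrable φ μ) : Integrable (fun z => φ z • fderiv ℝ h z) μ :=
  hφ.smul_bdd C (measurable_fderiv ℝ h).aestronglyMeasurable
    (ae_of_all _ fun _ => norm_fderiv_le_of_lipschitz ℝ hh)

variable [μ.IsAddHaarMeasure]

/-- Integration by parts of a Lipschitz map against a test function. -/
theorem LipschitzWith.integral_smul_fderiv_apply_eq (hh : LipschitzWith C h) {φ : V → ℝ}
    (hφ : ContDiff ℝ 1 φ) (hφc : HasCompactSupport φ) (v : V) :
    ∫ z, φ z • fderiv ℝ h z v ∂μ = ∫ z, -(fderiv ℝ φ z v) • h z ∂μ := by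
  obtain ⟨C', hφLip⟩ := ContDiff.lipschitzWith_of_hasCompactSupport hφc hφ one_ne_zero
  have hint₁ : Integrable (fun z => φ z • fderiv ℝ h z v) μ :=
    (hh.integrable_smul_fderiv (hφ.continuous.integrable_of_hasCompactSupport hφc))
      |>.apply_continuousLinearMap v
  have hint₂ : Integrable (fun z => -(fderiv ℝ φ z v) • h z) μ := by
    have hcont : Continuous fun z => fderiv ℝ φ z v :=
      (hφ.continuous_fderiv one_ne_zero).clm_apply continuous_const
    refine (hcont.neg.smul hh.continuous).integrable_of_hasCompactSupport ?_
    exact ((hφc.fderiv_apply (𝕜 := ℝ) v).neg).smul_right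
  rw [SeparatingDual.eq_iff_forall_dual_eq (R := ℝ)]
  intro l
  rw [← l.integral_comp_comm hint₁, ← l.integral_comp_comm hint₂]
  have hparts := (l.lipschitz.comp hh).integral_lineDeriv_mul_eq (μ := μ) hφLip hφc v
  calc ∫ z, l (φ z • fderiv ℝ h z v) ∂μ = ∫ z, lineDeriv ℝ (l ∘ h) z v * φ z ∂μ := by
        refine integral_congr_ae ?_
        filter_upwards [hh.ae_differentiableAt (μ := μ)] with z hz
        have hl := l.hasFDerivAt.comp z hz.hasFDerivAt
        rw [(hl.hasLineDerivAt v).lineDeriv]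
        simp [mul_comm]
    _ = ∫ z, lineDeriv ℝ φ z (-v) * (l ∘ h) z ∂μ := hparts
    _ = ∫ z, l (-(fderiv ℝ φ z v) • h z) ∂μ := by
        refine integral_congr_ae (ae_of_all _ fun z => ?_)
        have hz := (hφ.differentiable one_ne_zero z).lineDeriv_eq_fderiv (v := -v)
        simp [hz]

/-- The average of a function with values in a closed convex set against a bump function. -/
theorem ContDiffBump.integral_normed_smul_mem {X : Type*} [NormedAddCommGroup X]
    [NormedSpace ℝ X] [CompleteSpace X] {c : V} (φ : ContDiffBump c)
    {s : Set X} (hs : Convex ℝ s) (hsc : IsClosed s) {F : V → X}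
    (hF : ∀ᵐ z ∂μ, z ∈ ball c φ.rOut → F z ∈ s)
    (hFi : Integrable (fun z => φ.normed μ z • F z) μ) :
    ∫ z, φ.normed μ z • F z ∂μ ∈ s := by
  have hmeas : Measurable fun z => ENNReal.ofReal (φ.normed μ z) :=
    φ.continuous_normed.measurable.ennreal_ofReal
  have htop : ∀ᵐ z ∂μ, ENNReal.ofReal (φ.normed μ z) < ⊤ :=
    ae_of_all _ fun _ => ENNReal.ofReal_lt_top
  have hreal : ∀ z, (ENNReal.ofReal (φ.normed μ z)).toReal = φ.normed μ z :=
    fun z => ENNReal.toReal_ofReal (φ.nonneg_normed z)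
  have hprob : IsProbabilityMeasure (μ.withDensity fun z => ENNReal.ofReal (φ.normed μ z)) := by
    refine ⟨?_⟩
    rw [withDensity_apply _ MeasurableSet.univ, Measure.restrict_univ,
      ← ofReal_integral_eq_lintegral_ofReal φ.integrable_normed
        (ae_of_all _ φ.nonneg_normed), φ.integral_normed, ENNReal.ofReal_one]
  have hmem := hs.integral_mem (μ := μ.withDensity fun z => ENNReal.ofReal (φ.normed μ z))
    hsc (f := F) ?_ ?_
  · rw [integral_withDensity_eq_integral_toReal_smul hmeas htop] at hmem
    simpa only [hreal] using hmem
  · rw [ae_withDensity_iff hmeas]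
    filter_upwards [hF] with z hz hne
    refine hz ?_
    rw [← φ.support_normed_eq (μ := μ)]
    intro hzero
    simp [hzero] at hne
  · rw [integrable_withDensity_iff_integrable_smul' hmeas htop]
    simpa only [hreal] using hFi

/-- The derivative of a Lipschitz map at a point of differentiability belongs to every closed
convex set that contains almost all derivatives at nearby points. -/
theorem LipschitzWith.hasFDerivAt_mem_of_ae_fderiv_mem (μ : Measure V) [μ.IsAddHaarMeasure]
    (hh : LipschitzWith C h) {x : V} {A : V →L[ℝ] W} (hx : HasFDerivAt h A x) {r : ℝ} (hr : 0 < r)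
    {s : Set (V →L[ℝ] W)} (hs : Convex ℝ s) (hsc : IsClosed s)
    (hmem : ∀ᵐ y ∂μ, y ∈ ball x r → fderiv ℝ h y ∈ s) : A ∈ s := by
  let φ : ContDiffBump (0 : V) := ⟨1, 2, one_pos, one_lt_two⟩
  have hφ : ContDiff ℝ 1 (φ.normed μ) := φ.contDiff_normed
  have hφc : HasCompactSupport (φ.normed μ) := φ.hasCompactSupport_normed
  let H : ℝ → V → W := fun t z => t⁻¹ • (h (x + t • z) - h x)
  have hH : ∀ t ≠ 0, LipschitzWith C (H t) := by
    intro t ht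
    refine LipschitzWith.of_dist_le_mul fun y z => ?_
    have hle := hh.dist_le_mul (x + t • y) (x + t • z)
    rw [dist_add_left, dist_smul₀] at hle
    rw [dist_smul₀, dist_sub_right, norm_inv, inv_mul_le_iff₀ (norm_pos_iff.2 ht)]
    linarith
  have hderiv : ∀ t ≠ 0, ∀ z, DifferentiableAt ℝ h (x + t • z) →
      fderiv ℝ (H t) z = fderiv ℝ h (x + t • z) := by
    intro t ht z hz
    have haff : HasFDerivAt (fun z : V => x + t • z) (t • ContinuousLinearMap.id ℝ V) z :=
      ((hasFDerivAt_id z).const_smul t).const_add x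
    have hcomp := ((hz.hasFDerivAt.comp z haff).sub_const (h x)).const_smul t⁻¹
    refine hcomp.fderiv.trans ?_
    ext v
    simp [ht]
  have hlim : Tendsto (fun t => ∫ z, φ.normed μ z • fderiv ℝ (H t) z ∂μ) (𝓝[≠] 0) (𝓝 A) := by
    refine Tendsto.clm_of_forall_apply fun v => ?_
    have hA : A v = ∫ z, -(fderiv ℝ (φ.normed μ) z v) • A z ∂μ := by
      rw [← A.lipschitz.integral_smul_fderiv_apply_eq hφ hφc v]
      simp [φ.integral_normed_smul]
    have hcont : Continuous fun z => fderiv ℝ (φ.normed μ) z v :=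
      (hφ.continuous_fderiv one_ne_zero).clm_apply continuous_const
    have hev : ∀ᶠ t in 𝓝[≠] (0 : ℝ), t ≠ 0 := self_mem_nhdsWithin
    have hdom : Tendsto (fun t => ∫ z, -(fderiv ℝ (φ.normed μ) z v) • H t z ∂μ) (𝓝[≠] 0)
        (𝓝 (A v)) := by
      rw [hA]
      refine tendsto_integral_filter_of_dominated_convergence
        (fun z => ‖fderiv ℝ (φ.normed μ) z v‖ * (C * ‖z‖)) ?_ ?_ ?_ ?_
      · filter_upwards [hev] with t ht
        exact (hcont.neg.smul (hH t ht).continuous).aestronglyMeasurable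
      · filter_upwards [hev] with t ht
        refine ae_of_all _ fun z => ?_
        rw [norm_smul, norm_neg]
        gcongr
        simpa [H, dist_eq_norm] using (hH t ht).dist_le_mul z 0
      · refine Continuous.integrable_of_hasCompactSupport (by fun_prop) ?_
        exact ((hφc.fderiv_apply (𝕜 := ℝ) v).norm).mul_right
      · refine ae_of_all _ fun z => Tendsto.const_smul ?_ _
        exact (hasDerivAt_iff_tendsto_slope_zero.1 (hx.hasLineDerivAt z)).congr
          fun t => by simp [H]
    refine hdom.congr' ?_
    filter_upwards [hev] with t ht
    rw [ContinuousLinearMap.integral_apply ((hH t ht).integrable_smul_fderiv φ.integrable_normed)]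
    exact ((hH t ht).integral_smul_fderiv_apply_eq hφ hφc v).symm
  refine hsc.mem_of_tendsto hlim ?_
  have hsmall : ∀ᶠ t in 𝓝[≠] (0 : ℝ), |t| * 2 < r := by
    refine (Continuous.tendsto' (by fun_prop) _ _ ?_ : Tendsto (fun t : ℝ => |t| * 2) (𝓝 0)
      (𝓝 0)).mono_left nhdsWithin_le_nhds |>.eventually_lt_const hr
    simp
  filter_upwards [hsmall, self_mem_nhdsWithin] with t ht (ht0 : t ≠ 0)
  refine φ.integral_normed_smul_mem hs hsc ?_
    ((hH t ht0).integrable_smul_fderiv φ.integrable_normed)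
  have hsmul : Measure.QuasiMeasurePreserving (fun z : V => t • z) μ μ := by
    refine ⟨measurable_const_smul t, ?_⟩
    rw [Measure.map_addHaar_smul μ ht0]
    exact Measure.smul_absolutelyContinuous
  have haff := (measurePreserving_add_left μ x).quasiMeasurePreserving.comp hsmul
  filter_upwards [haff.ae (hmem.and (hh.ae_differentiableAt (μ := μ)))] with z hz hzball
  rw [hderiv t ht0 z hz.2]
  refine hz.1 ?_
  have hz2 : ‖z‖ < 2 := mem_ball_zero_iff.1 hzball
  simp only [Function.comp_apply, mem_ball, dist_self_add_left, norm_smul, Real.norm_eq_abs]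
  exact (mul_le_mul_of_nonneg_left hz2.le (abs_nonneg t)).trans_lt ht

end Averaging

end LipschitzDerivatives

section JacobianLimits

open Metric Set MeasureTheory
open scoped NNReal

variable {n m k : ℕ} {D : Set (EuclideanSpace ℝ (Fin n))}
  {f : EuclideanSpace ℝ (Fin n) → EuclideanSpace ℝ (Fin m)}
  {g : EuclideanSpace ℝ (Fin m) → EuclideanSpace ℝ (Fin k)}
  {p : EuclideanSpace ℝ (Fin n)}

/-- The limits of Jacobians of `f` along sequences of differentiability points tending to `p`. -/
def jacobianLimits (D : Set (EuclideanSpace ℝ (Fin n)))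
    (f : EuclideanSpace ℝ (Fin n) → EuclideanSpace ℝ (Fin m))
    (p : EuclideanSpace ℝ (Fin n)) :
    Set (EuclideanSpace ℝ (Fin n) →L[ℝ] EuclideanSpace ℝ (Fin m)) :=
  {A | ∃ u : ℕ → EuclideanSpace ℝ (Fin n),
    (∀ i, u i ∈ diffPts D f) ∧ Tendsto u atTop (𝓝 p) ∧
    Tendsto (fun i => fderiv ℝ f (u i)) atTop (𝓝 A)}

theorem isClosed_jacobianLimits : IsClosed (jacobianLimits D f p) := by
  have hpre : jacobianLimits D f p =
      Prod.mk p ⁻¹' closure ((fun x => (x, fderiv ℝ f x)) '' diffPts D f) := by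
    ext A
    rw [mem_preimage, mem_closure_iff_seq_limit]
    constructor
    · rintro ⟨u, hu, hup, huA⟩
      exact ⟨fun i => (u i, fderiv ℝ f (u i)), fun i => mem_image_of_mem _ (hu i),
        hup.prodMk_nhds huA⟩
    · rintro ⟨q, hq, hqlim⟩
      choose u hu huq using hq
      obtain rfl : (fun i => (u i, fderiv ℝ f (u i))) = q := funext huq
      exact ⟨u, hu, (continuous_fst.tendsto _).comp hqlim, (continuous_snd.tendsto _).comp hqlim⟩
  rw [hpre]
  exact isClosed_closure.preimage (by fun_prop)

theorem LipschitzOnWith.eventually_norm_fderiv_le {V W : Type*} [NormedAddCommGroup V]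
    [NormedSpace ℝ V] [NormedAddCommGroup W] [NormedSpace ℝ W] {f : V → W} {K : ℝ≥0} {U : Set V}
    {p : V} (hf : LipschitzOnWith K f U) (hU : U ∈ 𝓝 p) : ∀ᶠ y in 𝓝 p, ‖fderiv ℝ f y‖ ≤ K := by
  filter_upwards [eventually_mem_nhds_iff.2 hU] with y hy
  exact norm_fderiv_le_of_lipschitzOn ℝ hy hf

theorem LipschitzOnWith.isCompact_clarkeJacobian {K : ℝ≥0} {U : Set (EuclideanSpace ℝ (Fin n))}
    (hf : LipschitzOnWith K f U) (hU : U ∈ 𝓝 p) : IsCompact (clarkeJacobian D f p) := by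
  refine IsCompact.convexHull_of_finiteDimensional
    (isCompact_of_isClosed_isBounded isClosed_jacobianLimits
      (isBounded_closedBall.subset (t := closedBall 0 K) ?_))
  rintro A ⟨u, -, hup, huA⟩
  rw [mem_closedBall_zero_iff]
  exact le_of_tendsto huA.norm (hup.eventually (hf.eventually_norm_fderiv_le hU))

theorem ContDiffAt.tendsto_fderiv_comp {u : ℕ → EuclideanSpace ℝ (Fin n)}
    {A : EuclideanSpace ℝ (Fin n) →L[ℝ] EuclideanSpace ℝ (Fin m)}
    (hg : ContDiffAt ℝ 1 g (f p)) (hf : ContinuousAt f p) (hu : ∀ i, DifferentiableAt ℝ f (u i))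
    (hup : Tendsto u atTop (𝓝 p)) (huA : Tendsto (fun i => fderiv ℝ f (u i)) atTop (𝓝 A)) :
    Tendsto (fun i => fderiv ℝ (g ∘ f) (u i)) atTop (𝓝 ((fderiv ℝ g (f p)).comp A)) := by
  have hfu : Tendsto (fun i => f (u i)) atTop (𝓝 (f p)) := hf.tendsto.comp hup
  have hdg : ∀ᶠ y in 𝓝 (f p), DifferentiableAt ℝ g y :=
    (hg.eventually (by simp)).mono fun y hy => hy.differentiableAt one_ne_zero
  have hprod := (isBoundedBilinearMap_comp (𝕜 := ℝ)).continuous.continuousAt.tendsto.comp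
    (((hg.continuousAt_fderiv one_ne_zero).tendsto.comp hfu).prodMk_nhds huA)
  refine hprod.congr' ?_
  filter_upwards [hfu.eventually hdg] with i hi
  exact (fderiv_comp (u i) hi (hu i)).symm

theorem ContDiffAt.eventually_fderiv_comp_mem_cthickening {K : ℝ≥0}
    {U : Set (EuclideanSpace ℝ (Fin n))}
    (hg : ContDiffAt ℝ 1 g (f p)) (hf : LipschitzOnWith K f U) (hU : U ∈ 𝓝 p)
    {ε : ℝ} (hε : 0 < ε) :
    ∀ᶠ y in 𝓝 p, y ∈ diffPts D f → fderiv ℝ (g ∘ f) y ∈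
      cthickening ε ((fun A => (fderiv ℝ g (f p)).comp A) '' clarkeJacobian D f p) := by
  by_contra hnot
  have hfreq := (not_eventually.1 hnot).and_eventually (hf.eventually_norm_fderiv_le hU)
  obtain ⟨u, hup, hu⟩ := exists_seq_forall_of_frequently hfreq
  push Not at hu
  obtain ⟨A, -, ψ, hψ, hA⟩ := tendsto_subseq_of_bounded (isBounded_closedBall (x := 0) (r := K))
    (fun i => mem_closedBall_zero_iff.2 (hu i).2)
  have hupψ := hup.comp hψ.tendsto_atTop
  have hlim := hg.tendsto_fderiv_comp (hf.continuousOn.continuousAt hU)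
    (fun i => (hu (ψ i)).1.1.2) hupψ hA
  have hAmem : A ∈ clarkeJacobian D f p :=
    subset_convexHull ℝ _ ⟨u ∘ ψ, fun i => (hu (ψ i)).1.1, hupψ, hA⟩
  have hnear := hlim.eventually (isOpen_thickening.mem_nhds
    (self_subset_thickening hε _ (mem_image_of_mem _ hAmem)))
  obtain ⟨i, hi⟩ := hnear.exists
  exact (hu (ψ i)).1.2 (thickening_subset_cthickening _ _ hi)

theorem ContDiffAt.jacobianLimits_comp_subset {K : ℝ≥0} {U : Set (EuclideanSpace ℝ (Fin n))}
    (hg : ContDiffAt ℝ 1 g (f p)) (hD : D ∈ 𝓝 p) (hf : LipschitzOnWith K f U) (hU : U ∈ 𝓝 p) :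
    jacobianLimits D (g ∘ f) p ⊆
      (fun A => (fderiv ℝ g (f p)).comp A) '' clarkeJacobian D f p := by
  rintro B ⟨u, hu, hup, huB⟩
  set S := (fun A => (fderiv ℝ g (f p)).comp A) '' clarkeJacobian D f p
  have hScompact : IsCompact S := (hf.isCompact_clarkeJacobian hU).image (by fun_prop)
  have hSconvex : Convex ℝ S :=
    (convex_convexHull ℝ _).linear_image
      (ContinuousLinearMap.compL ℝ _ _ _ (fderiv ℝ g (f p))).toLinearMap
  rw [← hScompact.isClosed.closure_eq, closure_eq_iInter_cthickening]
  refine mem_iInter₂.2 fun ε hε => ?_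
  obtain ⟨K', T, hT, hgT⟩ := hg.exists_lipschitzOnWith
  have hfT : f ⁻¹' T ∈ 𝓝 p := (hf.continuousOn.continuousAt hU).preimage_mem_nhds hT
  obtain ⟨r, hr, hball⟩ := Metric.mem_nhds_iff.1 (inter_mem (inter_mem hD (inter_mem hU hfT))
    (hg.eventually_fderiv_comp_mem_cthickening (D := D) hf hU hε))
  have hfball : LipschitzOnWith K f (ball p r) := hf.mono fun y hy => (hball hy).1.2.1
  have hcomp : LipschitzOnWith (K' * K) (g ∘ f) (ball p r) :=
    hgT.comp hfball fun y hy => (hball hy).1.2.2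
  obtain ⟨h, hh, hEq⟩ := hcomp.extend_finite_dimension
  have hnhds : ∀ y ∈ ball p r, g ∘ f =ᶠ[𝓝 y] h := fun y hy =>
    hEq.eventuallyEq_of_mem (isOpen_ball.mem_nhds hy)
  have hae : ∀ᵐ y, y ∈ ball p r → fderiv ℝ h y ∈ cthickening ε S := by
    filter_upwards [hfball.ae_differentiableWithinAt_of_mem (μ := volume)] with y hy hyball
    rw [← (hnhds y hyball).fderiv_eq]
    exact (hball hyball).2
      ⟨(hball hyball).1.1, (hy hyball).differentiableAt (isOpen_ball.mem_nhds hyball)⟩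
  refine isClosed_cthickening.mem_of_tendsto huB ?_
  filter_upwards [hup.eventually (isOpen_ball.mem_nhds (mem_ball_self hr))] with i hi
  obtain ⟨δ, hδ, hδball⟩ := Metric.isOpen_iff.1 isOpen_ball _ hi
  refine hh.hasFDerivAt_mem_of_ae_fderiv_mem volume
    ((hu i).2.hasFDerivAt.congr_of_eventuallyEq (hnhds _ hi).symm) hδ
    (hSconvex.cthickening ε) isClosed_cthickening ?_
  filter_upwards [hae] with y hy hyδ using hy (hδball hyδ)

end JacobianLimits

/-- Chain rule for a C¹ outer map: `∂(g∘f)(p) ⊆ Dg(f(p)) ∘ ∂f(p)`, with equality when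
`Dg(f(p))` is injective. -/
theorem clarkeJacobian_chain_rule_smooth {n m k : ℕ}
    (D : Set (EuclideanSpace ℝ (Fin n))) (hD : IsOpen D)
    (f : EuclideanSpace ℝ (Fin n) → EuclideanSpace ℝ (Fin m))
    (hf : LocallyLipschitzOnSet D f)
    (E : Set (EuclideanSpace ℝ (Fin m))) (hE : IsOpen E) (hfDE : f '' D ⊆ E)
    (g : EuclideanSpace ℝ (Fin m) → EuclideanSpace ℝ (Fin k))
    (hg : ContDiffOn ℝ 1 g E)
    (p : EuclideanSpace ℝ (Fin n)) (hp : p ∈ D) :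
    clarkeJacobian D (g ∘ f) p ⊆
      (fun A => (fderiv ℝ g (f p)).comp A) '' clarkeJacobian D f p ∧
    (Function.Injective (fderiv ℝ g (f p)) →
      clarkeJacobian D (g ∘ f) p =
        (fun A => (fderiv ℝ g (f p)).comp A) '' clarkeJacobian D f p) := by
  have hgE : ∀ x ∈ D, ContDiffAt ℝ 1 g (f x) := fun x hx =>
    hg.contDiffAt (hE.mem_nhds (hfDE (Set.mem_image_of_mem f hx)))
  obtain ⟨K, U, hU, hfU⟩ := hf p hp
  let L := (ContinuousLinearMap.compL ℝ (EuclideanSpace ℝ (Fin n)) _ _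
    (fderiv ℝ g (f p))).toLinearMap
  have hsub : clarkeJacobian D (g ∘ f) p ⊆
      (fun A => (fderiv ℝ g (f p)).comp A) '' clarkeJacobian D f p :=
    convexHull_min ((hgE p hp).jacobianLimits_comp_subset (hD.mem_nhds hp) hfU hU)
      ((convex_convexHull ℝ _).linear_image L)
  refine ⟨hsub, fun _ => hsub.antisymm ?_⟩
  change L '' convexHull ℝ (jacobianLimits D f p) ⊆ convexHull ℝ (jacobianLimits D (g ∘ f) p)
  rw [L.image_convexHull]
  refine convexHull_mono ?_
  rintro _ ⟨A, ⟨u, hu, hup, huA⟩, rfl⟩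
  exact ⟨u, fun i => ⟨(hu i).1, ((hgE _ (hu i).1).differentiableAt one_ne_zero).comp _ (hu i).2⟩,
    hup, (hgE p hp).tendsto_fderiv_comp (hfU.continuousOn.continuousAt hU)
      (fun i => (hu i).2) hup huA⟩
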